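/- Let V be a multicomplex (free as a bigraded R-module, bounded below, concentrated in strictly positive total degrees), let A = (T[V],d) be the free multialgebra whose multidifferential is the multiderivation induced by the multidifferential of V, let B be a multialgebra, and let f', f'' : A → B be morphisms of multialgebras. Let A × I = T[V' ⊕ V'' ⊕ sV] be the cylinder on A, with V', V'' copies of V, (sV)_{p,q} = V_{p-1,q}, the multidifferential on V' and V'' copied from V, S : T[V] → A × I the i'-i''-multiderivation determined by Sv = sv (so S(ab) = S(a)b'' + (−1)^{|a|} a' S(b)), and the multidifferential on sV given by d^0(sv) = −S d^0 v, d^1(sv) = v'' − v' − S d^1 v, and d^j(sv) = −S d^j v for j ≥ 2, where i', i'' : A → A × I are the injections of bigraded algebras identifying V with V' and V''. Then the formulas H i' = f', H i'' = f'', H S = h determine a natural bijection between multihomotopies h : f' ≃ f'' of morphisms of multialgebras and morphisms H : A × I → B of multialgebras satisfying H i' = f' and H i'' = f''. -/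

import Mathlib

/-!
Framework: bigraded algebras are treated as internally graded `R`-algebras, i.e.
an `R`-algebra `A` with a family `𝒜 : ℤ × ℤ → Submodule R A` which is an internal
direct sum decomposition, compatible with the multiplication.  A multimorphism of
degree `0` is encoded by its family of components `f : ℕ → (A →ₗ[R] B)`, where
`f k` lowers column degree by `k` and raises row (complementary) degree by `k`;
composition of multimorphisms is by convolution.  For the tensor algebra `T[V]` on
a bigraded module `V` the induced bigrading is generated by products of
homogeneous elements of `V`.
-/

section TensorPreamble

variable (R : Type) [CommRing R]

/-- Convolution composition of multimorphisms: `(g ∘ f)^k = ∑_{i+j=k} g^i f^j`. -/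
def convE {A B C : Type} [AddCommGroup A] [Module R A] [AddCommGroup B] [Module R B]
    [AddCommGroup C] [Module R C] (g : ℕ → (B →ₗ[R] C)) (f : ℕ → (A →ₗ[R] B)) :
    ℕ → (A →ₗ[R] C) :=
  fun k => ∑ i ∈ Finset.range (k + 1), (g i).comp (f (k - i))

/-- The identity multimorphism. -/
def idE (A : Type) [AddCommGroup A] [Module R A] : ℕ → (A →ₗ[R] A) :=
  fun k => if k = 0 then LinearMap.id else 0

/-- Totalization of a multimorphism (pointwise, a finite sum in each argument in the
bounded situations considered below). -/
noncomputable def totE {A B : Type} [AddCommGroup A] [Module R A] [AddCommGroup B]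
    [Module R B] (f : ℕ → (A →ₗ[R] B)) : A → B :=
  fun x => ∑ᶠ k, f k x

variable (V : Type) [AddCommGroup V] [Module R V]

/-- The grading induced on the tensor algebra `T[V]` by a grading `𝒱` of `V`:
the piece of degree `n` is generated by all products of homogeneous elements of `V`
whose degrees add up to `n`. -/
def tGrade {ι : Type} [AddCommMonoid ι] (𝒱 : ι → Submodule R V) (n : ι) :
    Submodule R (TensorAlgebra R V) :=
  ⨆ (l : List ι) (_ : l.sum = n),
    (l.map fun i => Submodule.map (TensorAlgebra.ι R (M := V)) (𝒱 i)).prod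

/-- `V` (with grading `𝒱`) is a generating bigraded module for a free connected
multialgebra: the grading is an internal direct sum decomposition, concentrated in
strictly positive total degrees, and bounded below. -/
def IsFreeConnectedGen (𝒱 : ℤ × ℤ → Submodule R V) : Prop :=
  DirectSum.IsInternal 𝒱 ∧
  (∀ pq : ℤ × ℤ, pq.1 + pq.2 ≤ 0 → 𝒱 pq = ⊥) ∧
  (∀ n : ℤ, ∃ s : ℤ, ∀ pq : ℤ × ℤ, pq.1 + pq.2 = n → pq.1 < s → 𝒱 pq = ⊥)

/-- A multialgebra structure: `𝒜` is an internal bigrading of the `R`-algebra `A`,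
bounded below, and `d` is a multidifferential each of whose components satisfies the
Leibniz rule. -/
def IsMultialgebra (A : Type) [Ring A] [Algebra R A] (𝒜 : ℤ × ℤ → Submodule R A)
    (d : ℕ → (A →ₗ[R] A)) : Prop :=
  DirectSum.IsInternal 𝒜 ∧
  (1 : A) ∈ 𝒜 (0, 0) ∧
  (∀ pq pq' : ℤ × ℤ, ∀ a ∈ 𝒜 pq, ∀ b ∈ 𝒜 pq', a * b ∈ 𝒜 (pq.1 + pq'.1, pq.2 + pq'.2)) ∧
  (∀ n : ℤ, ∃ s : ℤ, ∀ pq : ℤ × ℤ, pq.1 + pq.2 = n → pq.1 < s → 𝒜 pq = ⊥) ∧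
  (∀ (i : ℕ) (pq : ℤ × ℤ), ∀ a ∈ 𝒜 pq, d i a ∈ 𝒜 (pq.1 - i, pq.2 + i - 1)) ∧
  (∀ (i : ℕ) (pq : ℤ × ℤ), ∀ a ∈ 𝒜 pq, ∀ b : A,
    d i (a * b) = d i a * b + (((-1 : ℤˣ) ^ (pq.1 + pq.2) : ℤˣ) : ℤ) • (a * d i b)) ∧
  (∀ n : ℕ, ∑ i ∈ Finset.range (n + 1), (d i).comp (d (n - i)) = 0)

/-- A morphism of multialgebras `(A, 𝒜, dA) → (B, ℬ, dB)`, given by its components. -/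
def IsMAlgMorphism {A B : Type} [Ring A] [Algebra R A] [Ring B] [Algebra R B]
    (𝒜 : ℤ × ℤ → Submodule R A) (ℬ : ℤ × ℤ → Submodule R B)
    (dA : ℕ → (A →ₗ[R] A)) (dB : ℕ → (B →ₗ[R] B)) (f : ℕ → (A →ₗ[R] B)) : Prop :=
  (∀ (k : ℕ) (pq : ℤ × ℤ), ∀ a ∈ 𝒜 pq, f k a ∈ ℬ (pq.1 - k, pq.2 + k)) ∧
  (∀ k, ∑ i ∈ Finset.range (k + 1), (dB i).comp (f (k - i)) =
    ∑ i ∈ Finset.range (k + 1), (f i).comp (dA (k - i))) ∧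
  (f 0 1 = 1) ∧ (∀ k, 0 < k → f k 1 = 0) ∧
  (∀ (k : ℕ) (a b : A), f k (a * b) = ∑ i ∈ Finset.range (k + 1), f i a * f (k - i) b)

/-- A multihomotopy of morphisms of multialgebras from `f` to `g`: `H k` encodes the
component `h^{k-1}` (so that the component `h^{-1}` is allowed), and `H` is an
`f`-`g`-multiderivation. -/
def IsMAlgHomotopy {A B : Type} [Ring A] [Algebra R A] [Ring B] [Algebra R B]
    (𝒜 : ℤ × ℤ → Submodule R A) (ℬ : ℤ × ℤ → Submodule R B)
    (dA : ℕ → (A →ₗ[R] A)) (dB : ℕ → (B →ₗ[R] B)) (f g H : ℕ → (A →ₗ[R] B)) : Prop :=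
  (∀ (k : ℕ) (pq : ℤ × ℤ), ∀ a ∈ 𝒜 pq, H k a ∈ ℬ (pq.1 - k + 1, pq.2 + k)) ∧
  (∀ m, ∑ i ∈ Finset.range (m + 1), ((dB i).comp (H (m - i)) + (H i).comp (dA (m - i))) =
    if m = 0 then 0 else g (m - 1) - f (m - 1)) ∧
  (∀ (k : ℕ) (pq : ℤ × ℤ), ∀ a ∈ 𝒜 pq, ∀ b : A,
    H k (a * b) = ∑ i ∈ Finset.range (k + 1),
      (H i a * g (k - i) b +
        (((-1 : ℤˣ) ^ (pq.1 + pq.2) : ℤˣ) : ℤ) • (f (k - i) a * H i b)))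

/-- A morphism of (internally graded) multicomplexes, given by its components. -/
def IsMCMorphismI {V W : Type} [AddCommGroup V] [Module R V] [AddCommGroup W] [Module R W]
    (𝒱 : ℤ × ℤ → Submodule R V) (𝒲 : ℤ × ℤ → Submodule R W)
    (dV : ℕ → (V →ₗ[R] V)) (dW : ℕ → (W →ₗ[R] W)) (f : ℕ → (V →ₗ[R] W)) : Prop :=
  (∀ (k : ℕ) (pq : ℤ × ℤ), ∀ v ∈ 𝒱 pq, f k v ∈ 𝒲 (pq.1 - k, pq.2 + k)) ∧
  ∀ k, ∑ i ∈ Finset.range (k + 1), (dW i).comp (f (k - i)) =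
    ∑ i ∈ Finset.range (k + 1), (f i).comp (dV (k - i))

/-- A multihomotopy of morphisms of (internally graded) multicomplexes from `f` to `g`;
`H k` encodes the component `h^{k-1}`. -/
def IsMCHomotopyI {V W : Type} [AddCommGroup V] [Module R V] [AddCommGroup W] [Module R W]
    (𝒱 : ℤ × ℤ → Submodule R V) (𝒲 : ℤ × ℤ → Submodule R W)
    (dV : ℕ → (V →ₗ[R] V)) (dW : ℕ → (W →ₗ[R] W)) (f g H : ℕ → (V →ₗ[R] W)) : Prop :=
  (∀ (k : ℕ) (pq : ℤ × ℤ), ∀ v ∈ 𝒱 pq, H k v ∈ 𝒲 (pq.1 - k + 1, pq.2 + k)) ∧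
  ∀ m, ∑ i ∈ Finset.range (m + 1), ((dW i).comp (H (m - i)) + (H i).comp (dV (m - i))) =
    if m = 0 then 0 else g (m - 1) - f (m - 1)

/-- The linear part `β₁` of a multidifferential `d` on `T[V]`: the component of the
restriction of `d` to `V` which lands in `V ⊆ T[V]`. -/
noncomputable def betaOne (d : ℕ → (TensorAlgebra R V →ₗ[R] TensorAlgebra R V)) (i : ℕ) :
    V →ₗ[R] V :=
  (TensorAlgebra.ιInv (R := R) (M := V)).comp ((d i).comp (TensorAlgebra.ι R))

/-- The `q`-th column filtration level of an internally bigraded module. -/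
def colFilI {A : Type} [AddCommGroup A] [Module R A] (𝒜 : ℤ × ℤ → Submodule R A)
    (q : ℤ) : Submodule R A :=
  ⨆ (pq : ℤ × ℤ) (_ : pq.1 ≤ q), 𝒜 pq

/-- The totalization of the multimorphism `g` restricts, on every column filtration
level, to a homology isomorphism (weak multiequivalence, cf. Lemma 1.12.3). -/
def InducesColHomologyIsoI {A B : Type} [AddCommGroup A] [Module R A] [AddCommGroup B]
    [Module R B] (𝒜 : ℤ × ℤ → Submodule R A) (ℬ : ℤ × ℤ → Submodule R B)
    (dA : ℕ → (A →ₗ[R] A)) (dB : ℕ → (B →ₗ[R] B)) (g : ℕ → (A →ₗ[R] B)) : Prop :=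
  ∀ q : ℤ,
    (∀ y ∈ colFilI R ℬ q, totE R dB y = 0 →
      ∃ x ∈ colFilI R 𝒜 q, ∃ z ∈ colFilI R ℬ q,
        totE R dA x = 0 ∧ y = totE R g x + totE R dB z) ∧
    (∀ x ∈ colFilI R 𝒜 q, totE R dA x = 0 →
      (∃ z ∈ colFilI R ℬ q, totE R g x = totE R dB z) →
      ∃ w ∈ colFilI R 𝒜 q, x = totE R dA w)

end TensorPreamble
section CylinderDefs

variable (R V : Type) [CommRing R] [AddCommGroup V] [Module R V]

/-- First copy `V'` of `V` inside `V' ⊕ V'' ⊕ sV`. -/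
def cylE1 : V →ₗ[R] V × V × V := LinearMap.inl R V (V × V)

/-- Second copy `V''` of `V` inside `V' ⊕ V'' ⊕ sV`. -/
def cylE2 : V →ₗ[R] V × V × V := (LinearMap.inr R V (V × V)).comp (LinearMap.inl R V V)

/-- The suspension copy `sV` of `V` inside `V' ⊕ V'' ⊕ sV` (the suspension operator). -/
def cylE3 : V →ₗ[R] V × V × V := (LinearMap.inr R V (V × V)).comp (LinearMap.inr R V V)

/-- The bigrading of `V' ⊕ V'' ⊕ sV`, where `(sV)_{p,q} = V_{p-1,q}`. -/
def cylGrade (𝒱 : ℤ × ℤ → Submodule R V) (pq : ℤ × ℤ) : Submodule R (V × V × V) :=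
  (𝒱 pq).prod ((𝒱 pq).prod (𝒱 (pq.1 - 1, pq.2)))

/-- The injection `i' : T[V] → T[V' ⊕ V'' ⊕ sV]` of bigraded algebras. -/
noncomputable def cylI' : TensorAlgebra R V →ₐ[R] TensorAlgebra R (V × V × V) :=
  TensorAlgebra.lift R ((TensorAlgebra.ι R).comp (cylE1 R V))

/-- The injection `i'' : T[V] → T[V' ⊕ V'' ⊕ sV]` of bigraded algebras. -/
noncomputable def cylI'' : TensorAlgebra R V →ₐ[R] TensorAlgebra R (V × V × V) :=
  TensorAlgebra.lift R ((TensorAlgebra.ι R).comp (cylE2 R V))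

end CylinderDefs

section TensorInduction

variable {R W : Type} [CommRing R] [AddCommGroup W] [Module R W]

/-- A submodule of a tensor algebra containing `1` and stable under left multiplication by
homogeneous generators is everything. -/
theorem TensorAlgebra.mem_of_ι_mul_mem {ι : Type} {𝒲 : ι → Submodule R W} (h𝒲 : ⨆ i, 𝒲 i = ⊤)
    (N : Submodule R (TensorAlgebra R W)) (h1 : (1 : TensorAlgebra R W) ∈ N)
    (hmul : ∀ i, ∀ w ∈ 𝒲 i, ∀ b ∈ N, TensorAlgebra.ι R w * b ∈ N)
    (x : TensorAlgebra R W) : x ∈ N := by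
  have key : ∀ b ∈ N, x * b ∈ N := by
    induction x using TensorAlgebra.induction with
    | algebraMap r =>
      intro b hb
      rw [← Algebra.smul_def]
      exact N.smul_mem r hb
    | ι w =>
      intro b hb
      have hle : ⨆ i, 𝒲 i ≤
          N.comap ((LinearMap.mulRight R b).comp (TensorAlgebra.ι R (M := W))) :=
        iSup_le fun i w hw => hmul i w hw b hb
      exact hle (h𝒲 ▸ Submodule.mem_top)
    | mul a c ha hc =>
      intro b hb
      rw [mul_assoc]
      exact ha _ (hc _ hb)
    | add a c ha hc =>
      intro b hb
      rw [add_mul]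
      exact N.add_mem (ha _ hb) (hc _ hb)
  simpa using key 1 h1

theorem ι_mem_tGrade {ι : Type} [AddCommMonoid ι] {𝒲 : ι → Submodule R W} {i : ι} {w : W}
    (hw : w ∈ 𝒲 i) : TensorAlgebra.ι R w ∈ tGrade R W 𝒲 i := by
  have hle : Submodule.map (TensorAlgebra.ι R (M := W)) (𝒲 i) ≤ tGrade R W 𝒲 i := by
    refine le_trans ?_ (le_iSup₂_of_le [i] (by simp) le_rfl)
    simp
  exact hle (Submodule.mem_map_of_mem hw)

/-- The induced grading is the smallest family containing `1` and stable under left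
multiplication by homogeneous generators. -/
theorem tGrade_le {ι : Type} [AddCommMonoid ι] {𝒲 : ι → Submodule R W}
    (N : ι → Submodule R (TensorAlgebra R W)) (h1 : (1 : TensorAlgebra R W) ∈ N 0)
    (hmul : ∀ i n, ∀ w ∈ 𝒲 i, ∀ b ∈ N n, TensorAlgebra.ι R w * b ∈ N (i + n)) (n : ι) :
    tGrade R W 𝒲 n ≤ N n := by
  refine iSup₂_le ?_
  rintro l rfl
  induction l with
  | nil => simpa [Submodule.one_le] using h1
  | cons i l ih =>
    simp only [List.map_cons, List.prod_cons, List.sum_cons]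
    rw [Submodule.mul_le]
    rintro _ ⟨w, hw, rfl⟩ b hb
    exact hmul i _ w hw b (ih hb)

end TensorInduction

section Multiplicative

variable {R A B W : Type} [CommRing R] [Ring A] [Algebra R A] [Ring B] [Algebra R B]
  [AddCommGroup W] [Module R W]

/-- A sequence of linear maps, as a linear map to power series. -/
noncomputable def seriesMap (φ : ℕ → (W →ₗ[R] B)) : W →ₗ[R] PowerSeries B where
  toFun w := PowerSeries.mk fun k => φ k w
  map_add' x y := by ext k; simp
  map_smul' r x := by ext k; simp

/-- The multiplicative extension to the tensor algebra of a sequence of linear maps on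
the generators. -/
noncomputable def multExt (φ : ℕ → (W →ₗ[R] B)) (k : ℕ) : TensorAlgebra R W →ₗ[R] B where
  toFun x := PowerSeries.coeff k (TensorAlgebra.lift R (seriesMap φ) x)
  map_add' x y := by simp
  map_smul' r x := by simp

theorem multExt_ι (φ : ℕ → (W →ₗ[R] B)) (k : ℕ) (w : W) :
    multExt φ k (TensorAlgebra.ι R w) = φ k w := by
  simp [multExt, seriesMap]

theorem multExt_one (φ : ℕ → (W →ₗ[R] B)) (k : ℕ) :
    multExt φ k 1 = if k = 0 then 1 else 0 := by
  simp [multExt, PowerSeries.coeff_one]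

theorem multExt_mul (φ : ℕ → (W →ₗ[R] B)) (k : ℕ) (a b : TensorAlgebra R W) :
    multExt φ k (a * b) = ∑ i ∈ Finset.range (k + 1), multExt φ i a * multExt φ (k - i) b := by
  simp only [multExt, LinearMap.coe_mk, AddHom.coe_mk, map_mul, PowerSeries.coeff_mul]
  exact Finset.Nat.sum_antidiagonal_eq_sum_range_succ (fun i j =>
    PowerSeries.coeff i (TensorAlgebra.lift R (seriesMap φ) a) *
    PowerSeries.coeff j (TensorAlgebra.lift R (seriesMap φ) b)) k

theorem sum_range_triple_assoc {M : Type} [AddCommMonoid M] (k : ℕ) (f : ℕ → ℕ → ℕ → M) :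
    ∑ i ∈ Finset.range (k + 1), ∑ j ∈ Finset.range (k - i + 1), f i j (k - i - j) =
      ∑ n ∈ Finset.range (k + 1), ∑ i ∈ Finset.range (n + 1), f i (n - i) (k - n) := by
  rw [Finset.sum_sigma', Finset.sum_sigma']
  refine Finset.sum_bij' (fun x _ => ⟨x.1 + x.2, x.1⟩) (fun x _ => ⟨x.2, x.1 - x.2⟩) ?_ ?_ ?_ ?_ ?_
  all_goals
    rintro ⟨i, j⟩ h
    simp only [Finset.mem_sigma, Finset.mem_range] at h ⊢
  · omega
  · omega
  · simp
  · simp; omega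
  · congr 1 <;> omega

theorem sum_range_triple_comm {M : Type} [AddCommMonoid M] (k : ℕ) (f : ℕ → ℕ → ℕ → M) :
    ∑ i ∈ Finset.range (k + 1), ∑ j ∈ Finset.range (k - i + 1), f i j (k - i - j) =
      ∑ j ∈ Finset.range (k + 1), ∑ i ∈ Finset.range (k - j + 1), f i j (k - j - i) := by
  rw [Finset.sum_sigma', Finset.sum_sigma']
  refine Finset.sum_bij' (fun x _ => ⟨x.2, x.1⟩) (fun x _ => ⟨x.2, x.1⟩) ?_ ?_ ?_ ?_ ?_
  all_goals
    rintro ⟨i, j⟩ h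
    simp only [Finset.mem_sigma, Finset.mem_range] at h ⊢
  · omega
  · omega
  · congr 1; omega

theorem sum_range_reflect_sub {M : Type} [AddCommMonoid M] (n : ℕ) (f : ℕ → ℕ → M) :
    ∑ i ∈ Finset.range (n + 1), f i (n - i) = ∑ i ∈ Finset.range (n + 1), f (n - i) i := by
  rw [← Finset.sum_range_reflect]
  refine Finset.sum_congr rfl fun i hi => ?_
  rw [Finset.mem_range] at hi
  congr 1; omega

/-- The multimorphism identity `d H = H d` holds on a product if it holds on both factors. -/
theorem multidifferential_comm_mul (dA : ℕ → (A →ₗ[R] A)) (dB : ℕ → (B →ₗ[R] B))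
    (H : ℕ → (A →ₗ[R] B)) (a b : A) (s : ℤ)
    (hH : ∀ (k : ℕ) (a b : A), H k (a * b) = ∑ i ∈ Finset.range (k + 1), H i a * H (k - i) b)
    (hdA : ∀ i, dA i (a * b) = dA i a * b + s • (a * dA i b))
    (hdB : ∀ i j y, dB i (H j a * y) = dB i (H j a) * y + s • (H j a * dB i y))
    (ha : ∀ k, ∑ i ∈ Finset.range (k + 1), dB i (H (k - i) a) =
      ∑ i ∈ Finset.range (k + 1), H i (dA (k - i) a))
    (hb : ∀ k, ∑ i ∈ Finset.range (k + 1), dB i (H (k - i) b) =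
      ∑ i ∈ Finset.range (k + 1), H i (dA (k - i) b)) (k : ℕ) :
    ∑ i ∈ Finset.range (k + 1), dB i (H (k - i) (a * b)) =
      ∑ i ∈ Finset.range (k + 1), H i (dA (k - i) (a * b)) := by
  have hs : ∀ (z : ℤ) (x y : B), x * (z • y) = z • (x * y) := fun z x y =>
    mul_smul_comm z x y
  have lhs : ∀ i ∈ Finset.range (k + 1), dB i (H (k - i) (a * b)) =
      ∑ j ∈ Finset.range (k - i + 1), (dB i (H j a) * H (k - i - j) b) +
        ∑ j ∈ Finset.range (k - i + 1), s • (H j a * dB i (H (k - i - j) b)) := by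
    intro i _
    rw [hH, map_sum, ← Finset.sum_add_distrib]
    exact Finset.sum_congr rfl fun j _ => hdB _ _ _
  have rhs : ∀ i ∈ Finset.range (k + 1), H (k - i) (dA i (a * b)) =
      ∑ j ∈ Finset.range (k - i + 1), (H j (dA i a) * H (k - i - j) b) +
        ∑ j ∈ Finset.range (k - i + 1), s • (H j a * H (k - i - j) (dA i b)) := by
    intro i _
    rw [hdA, map_add, map_zsmul, hH, hH, Finset.smul_sum]
  rw [sum_range_reflect_sub k fun i j => H i (dA j (a * b)), Finset.sum_congr rfl lhs, Finset.sum_congr rfl rhs,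
    Finset.sum_add_distrib, Finset.sum_add_distrib,
    sum_range_triple_assoc k fun i j l => dB i (H j a) * H l b,
    sum_range_triple_assoc k fun i j l => H j (dA i a) * H l b,
    sum_range_triple_comm k fun i j l => s • (H j a * dB i (H l b)),
    sum_range_triple_comm k fun i j l => s • (H j a * H l (dA i b))]
  congr 1
  · refine Finset.sum_congr rfl fun n _ => ?_
    rw [← Finset.sum_mul, ← Finset.sum_mul, ha, sum_range_reflect_sub n fun i j => H i (dA j a)]
  · refine Finset.sum_congr rfl fun n _ => ?_
    rw [← Finset.smul_sum, ← Finset.smul_sum, ← Finset.mul_sum, ← Finset.mul_sum, hb,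
      sum_range_reflect_sub (k - n) fun i j => H i (dA j b)]

theorem IsMultialgebra.differential_one {𝒜 : ℤ × ℤ → Submodule R A} {d : ℕ → (A →ₗ[R] A)}
    (hd : IsMultialgebra R A 𝒜 d) (j : ℕ) : d j 1 = 0 := by
  simpa using hd.2.2.2.2.2.1 j (0, 0) 1 hd.2.1 1

/-- Multiplicative families on a tensor algebra agreeing on generators are equal. -/
theorem multiplicative_ext (F G : ℕ → (TensorAlgebra R W →ₗ[R] B))
    (h1 : ∀ k, F k 1 = G k 1)
    (hF : ∀ (k : ℕ) (a b : TensorAlgebra R W),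
      F k (a * b) = ∑ i ∈ Finset.range (k + 1), F i a * F (k - i) b)
    (hG : ∀ (k : ℕ) (a b : TensorAlgebra R W),
      G k (a * b) = ∑ i ∈ Finset.range (k + 1), G i a * G (k - i) b)
    (hι : ∀ k w, F k (TensorAlgebra.ι R w) = G k (TensorAlgebra.ι R w)) : F = G := by
  have key : ∀ x, x ∈ ⨅ k, LinearMap.ker (F k - G k) := by
    refine TensorAlgebra.mem_of_ι_mul_mem (𝒲 := fun _ : Unit => (⊤ : Submodule R W))
      (by simp) _ ?_ ?_
    · simp [h1]
    · intro _ w _ b hb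
      simp only [Submodule.mem_iInf, LinearMap.mem_ker, LinearMap.sub_apply, sub_eq_zero] at hb ⊢
      intro k
      rw [hF, hG]
      exact Finset.sum_congr rfl fun i _ => by rw [hι, hb]
  funext k
  refine LinearMap.ext fun x => ?_
  have := key x
  simp only [Submodule.mem_iInf, LinearMap.mem_ker, LinearMap.sub_apply, sub_eq_zero] at this
  exact this k

theorem sum_range_ite_sub_eq_one {M : Type} [AddCommGroup M] [Module R M]
    (F : ℕ → (A →ₗ[R] M)) (m : ℕ) (y : A) :
    ∑ i ∈ Finset.range (m + 1), F i (if m - i = 1 then y else 0) =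
      if m = 0 then 0 else F (m - 1) y := by
  rcases m with _ | n
  · simp
  · rw [Finset.sum_eq_single n]
    · simp
    · intro i hi hin
      rw [Finset.mem_range] at hi
      rw [if_neg (by omega), map_zero]
    · simp

end Multiplicative

section Cylinder

variable {R V : Type} [CommRing R] [AddCommGroup V] [Module R V]

theorem cylI'_ι (v : V) :
    cylI' R V (TensorAlgebra.ι R v) = TensorAlgebra.ι R (cylE1 R V v) := by
  simp [cylI']

theorem cylI''_ι (v : V) :
    cylI'' R V (TensorAlgebra.ι R v) = TensorAlgebra.ι R (cylE2 R V v) := by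
  simp [cylI'']

theorem cylE1_mem {𝒱 : ℤ × ℤ → Submodule R V} {pq : ℤ × ℤ} {v : V} (hv : v ∈ 𝒱 pq) :
    cylE1 R V v ∈ cylGrade R V 𝒱 pq := by
  simp [cylGrade, cylE1, hv]

theorem cylE2_mem {𝒱 : ℤ × ℤ → Submodule R V} {pq : ℤ × ℤ} {v : V} (hv : v ∈ 𝒱 pq) :
    cylE2 R V v ∈ cylGrade R V 𝒱 pq := by
  simp [cylGrade, cylE2, hv]

theorem cylE3_mem {𝒱 : ℤ × ℤ → Submodule R V} {pq : ℤ × ℤ} {v : V} (hv : v ∈ 𝒱 pq) :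
    cylE3 R V v ∈ cylGrade R V 𝒱 (pq.1 + 1, pq.2) := by
  simp [cylGrade, cylE3, hv]

theorem cyl_decomp (w : V × V × V) :
    w = cylE1 R V w.1 + cylE2 R V w.2.1 + cylE3 R V w.2.2 := by
  simp [cylE1, cylE2, cylE3]

theorem iSup_cylGrade {𝒱 : ℤ × ℤ → Submodule R V} (h𝒱 : ⨆ i, 𝒱 i = ⊤) :
    ⨆ i, cylGrade R V 𝒱 i = ⊤ := by
  rw [eq_top_iff]
  rintro w -
  have hle : ∀ e : V →ₗ[R] V × V × V, (∀ pq, ∀ v ∈ 𝒱 pq, ∃ n, e v ∈ cylGrade R V 𝒱 n) →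
      ∀ v, e v ∈ ⨆ i, cylGrade R V 𝒱 i := by
    intro e he v
    have : ⨆ i, 𝒱 i ≤ (⨆ i, cylGrade R V 𝒱 i).comap e := iSup_le fun pq v hv => by
      obtain ⟨n, hn⟩ := he pq v hv
      exact Submodule.mem_iSup_of_mem n hn
    exact this (h𝒱 ▸ Submodule.mem_top)
  rw [cyl_decomp (R := R) w]
  refine add_mem (add_mem ?_ ?_) ?_
  · exact hle _ (fun _ _ hv => ⟨_, cylE1_mem hv⟩) _
  · exact hle _ (fun _ _ hv => ⟨_, cylE2_mem hv⟩) _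
  · exact hle _ (fun _ _ hv => ⟨_, cylE3_mem hv⟩) _

theorem neg_one_zpow_eq_or (n : ℤ) :
    (((-1 : ℤˣ) ^ n : ℤˣ) : ℤ) = 1 ∨ (((-1 : ℤˣ) ^ n : ℤˣ) : ℤ) = -1 := by
  rcases Int.units_eq_one_or ((-1 : ℤˣ) ^ n) with h | h <;> simp [h]

/-- The multiderivation `S` is a homotopy from `i'` to `i''`. -/
theorem cyl_homotopy {𝒱 : ℤ × ℤ → Submodule R V} (h𝒱 : ⨆ i, 𝒱 i = ⊤)
    {d : ℕ → (TensorAlgebra R V →ₗ[R] TensorAlgebra R V)}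
    (hd : IsMultialgebra R (TensorAlgebra R V) (tGrade R V 𝒱) d)
    {D : ℕ → (TensorAlgebra R (V × V × V) →ₗ[R] TensorAlgebra R (V × V × V))}
    (hD : IsMultialgebra R (TensorAlgebra R (V × V × V))
      (tGrade R (V × V × V) (cylGrade R V 𝒱)) D)
    (hDi' : ∀ i, (D i).comp (cylI' R V).toLinearMap = (cylI' R V).toLinearMap.comp (d i))
    (hDi'' : ∀ i, (D i).comp (cylI'' R V).toLinearMap = (cylI'' R V).toLinearMap.comp (d i))
    {S : TensorAlgebra R V →ₗ[R] TensorAlgebra R (V × V × V)}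
    (hSv : ∀ v : V, S (TensorAlgebra.ι R v) = TensorAlgebra.ι R (cylE3 R V v))
    (hS1 : S 1 = 0)
    (hSder : ∀ (pq : ℤ × ℤ), ∀ a ∈ tGrade R V 𝒱 pq, ∀ b : TensorAlgebra R V,
      S (a * b) = S a * cylI'' R V b +
        (((-1 : ℤˣ) ^ (pq.1 + pq.2) : ℤˣ) : ℤ) • (cylI' R V a * S b))
    (hDs : ∀ (j : ℕ) (v : V), D j (S (TensorAlgebra.ι R v)) + S (d j (TensorAlgebra.ι R v)) =
      if j = 1 then cylI'' R V (TensorAlgebra.ι R v) - cylI' R V (TensorAlgebra.ι R v) else 0)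
    (j : ℕ) (x : TensorAlgebra R V) :
    D j (S x) + S (d j x) = if j = 1 then cylI'' R V x - cylI' R V x else 0 := by
  let N : Submodule R (TensorAlgebra R V) :=
    LinearMap.ker ((D j).comp S + S.comp (d j) -
      (if j = 1 then (cylI'' R V).toLinearMap - (cylI' R V).toLinearMap else 0))
  have hN : ∀ y, y ∈ N ↔
      D j (S y) + S (d j y) = if j = 1 then cylI'' R V y - cylI' R V y else 0 := by
    intro y
    rw [LinearMap.mem_ker, LinearMap.sub_apply, sub_eq_zero]
    split_ifs <;> simp
  rw [← hN]
  refine TensorAlgebra.mem_of_ι_mul_mem h𝒱 N ?_ ?_ x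
  · rw [hN]
    simp [hS1, hd.differential_one]
  · intro pq v hv b hb
    rw [hN] at hb ⊢
    have hι := ι_mem_tGrade (R := R) hv
    have hSι : S (TensorAlgebra.ι R v) ∈
        tGrade R (V × V × V) (cylGrade R V 𝒱) (pq.1 + 1, pq.2) := by
      rw [hSv]; exact ι_mem_tGrade (cylE3_mem hv)
    have hι' : cylI' R V (TensorAlgebra.ι R v) ∈
        tGrade R (V × V × V) (cylGrade R V 𝒱) pq := by
      rw [cylI'_ι]; exact ι_mem_tGrade (cylE1_mem hv)
    have hv0 := hDs j v
    have e1 : ∀ y, D j (cylI' R V y) = cylI' R V (d j y) := fun y =>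
      LinearMap.congr_fun (hDi' j) y
    have e2 : ∀ y, D j (cylI'' R V y) = cylI'' R V (d j y) := fun y =>
      LinearMap.congr_fun (hDi'' j) y
    have s1 : (((-1 : ℤˣ) ^ (pq.1 + 1 + pq.2) : ℤˣ) : ℤ) =
        - (((-1 : ℤˣ) ^ (pq.1 + pq.2) : ℤˣ) : ℤ) := by
      rw [show pq.1 + 1 + pq.2 = pq.1 + pq.2 + 1 by ring, zpow_add_one]; simp
    have s2 : (((-1 : ℤˣ) ^ (pq.1 - j + (pq.2 + j - 1)) : ℤˣ) : ℤ) =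
        - (((-1 : ℤˣ) ^ (pq.1 + pq.2) : ℤˣ) : ℤ) := by
      rw [show pq.1 - j + (pq.2 + j - 1) = pq.1 + pq.2 - 1 by ring, zpow_sub_one]; simp
    rw [hSder pq _ hι, hd.2.2.2.2.2.1 j pq _ hι, map_add, map_add, map_zsmul, map_zsmul,
      hSder _ _ (hd.2.2.2.2.1 j pq _ hι), hSder pq _ hι, hD.2.2.2.2.2.1 j _ _ hSι,
      hD.2.2.2.2.2.1 j _ _ hι', e1, e2, s1, s2]
    have key : (if j = 1 then
          cylI'' R V (TensorAlgebra.ι R v * b) - cylI' R V (TensorAlgebra.ι R v * b) else 0) =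
        (D j (S (TensorAlgebra.ι R v)) + S (d j (TensorAlgebra.ι R v))) * cylI'' R V b +
          cylI' R V (TensorAlgebra.ι R v) * (D j (S b) + S (d j b)) := by
      rw [hv0, hb]
      split_ifs
      · rw [map_mul, map_mul]; noncomm_ring
      · simp
    rw [key]
    rcases neg_one_zpow_eq_or (pq.1 + pq.2) with h | h <;> rw [h] <;> noncomm_ring

/-- The multiderivation `S` raises the column degree by one. -/
theorem cyl_S_mem {𝒱 : ℤ × ℤ → Submodule R V}
    {D : ℕ → (TensorAlgebra R (V × V × V) →ₗ[R] TensorAlgebra R (V × V × V))}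
    (hD : IsMultialgebra R (TensorAlgebra R (V × V × V))
      (tGrade R (V × V × V) (cylGrade R V 𝒱)) D)
    {S : TensorAlgebra R V →ₗ[R] TensorAlgebra R (V × V × V)}
    (hSv : ∀ v : V, S (TensorAlgebra.ι R v) = TensorAlgebra.ι R (cylE3 R V v))
    (hS1 : S 1 = 0)
    (hSder : ∀ (pq : ℤ × ℤ), ∀ a ∈ tGrade R V 𝒱 pq, ∀ b : TensorAlgebra R V,
      S (a * b) = S a * cylI'' R V b +
        (((-1 : ℤˣ) ^ (pq.1 + pq.2) : ℤˣ) : ℤ) • (cylI' R V a * S b))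
    (pq : ℤ × ℤ) {a : TensorAlgebra R V} (ha : a ∈ tGrade R V 𝒱 pq) :
    S a ∈ tGrade R (V × V × V) (cylGrade R V 𝒱) (pq.1 + 1, pq.2) := by
  refine (tGrade_le (fun n => (tGrade R (V × V × V) (cylGrade R V 𝒱) n).comap
      (cylI'' R V).toLinearMap ⊓
    (tGrade R (V × V × V) (cylGrade R V 𝒱) (n.1 + 1, n.2)).comap S) ?_ ?_ pq ha).2
  · refine ⟨?_, ?_⟩
    · change cylI'' R V 1 ∈ tGrade R (V × V × V) (cylGrade R V 𝒱) (0, 0)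
      rw [map_one]
      exact hD.2.1
    · simp [hS1]
  · rintro i n v hv b ⟨hb1, hb2⟩
    replace hb1 : cylI'' R V b ∈ tGrade R (V × V × V) (cylGrade R V 𝒱) n := hb1
    replace hb2 : S b ∈ tGrade R (V × V × V) (cylGrade R V 𝒱) (n.1 + 1, n.2) := hb2
    refine ⟨?_, ?_⟩
    · simp only [SetLike.mem_coe, Submodule.mem_comap, AlgHom.toLinearMap_apply, map_mul]
      rw [cylI''_ι]
      exact hD.2.2.1 _ _ _ (ι_mem_tGrade (cylE2_mem hv)) _ hb1
    · simp only [SetLike.mem_coe, Submodule.mem_comap]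
      rw [hSder _ _ (ι_mem_tGrade hv), hSv, cylI'_ι]
      refine add_mem ?_ (zsmul_mem ?_ _)
      · convert hD.2.2.1 _ _ _ (ι_mem_tGrade (cylE3_mem hv)) _ hb1 using 2
        simp only [Prod.fst_add, Prod.snd_add, Prod.mk.injEq, and_true]
        ring
      · convert hD.2.2.1 _ _ _ (ι_mem_tGrade (cylE1_mem hv)) _ hb2 using 2
        simp only [Prod.fst_add, Prod.snd_add, Prod.mk.injEq, and_true]
        ring

end Cylinder

section Extension

/-- A multihomotopy between morphisms out of `T[V]` extends uniquely to the cylinder. -/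
theorem existsUnique_morphism_of_homotopy {R V B : Type} [CommRing R]
    [AddCommGroup V] [Module R V] [Ring B] [Algebra R B]
    {𝒱 : ℤ × ℤ → Submodule R V} (h𝒱 : ⨆ i, 𝒱 i = ⊤)
    {d : ℕ → (TensorAlgebra R V →ₗ[R] TensorAlgebra R V)}
    {D : ℕ → (TensorAlgebra R (V × V × V) →ₗ[R] TensorAlgebra R (V × V × V))}
    (hD : IsMultialgebra R (TensorAlgebra R (V × V × V))
      (tGrade R (V × V × V) (cylGrade R V 𝒱)) D)
    (hDi' : ∀ i, (D i).comp (cylI' R V).toLinearMap = (cylI' R V).toLinearMap.comp (d i))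
    (hDi'' : ∀ i, (D i).comp (cylI'' R V).toLinearMap = (cylI'' R V).toLinearMap.comp (d i))
    {S : TensorAlgebra R V →ₗ[R] TensorAlgebra R (V × V × V)}
    (hSv : ∀ v : V, S (TensorAlgebra.ι R v) = TensorAlgebra.ι R (cylE3 R V v))
    (hS1 : S 1 = 0)
    (hSder : ∀ (pq : ℤ × ℤ), ∀ a ∈ tGrade R V 𝒱 pq, ∀ b : TensorAlgebra R V,
      S (a * b) = S a * cylI'' R V b +
        (((-1 : ℤˣ) ^ (pq.1 + pq.2) : ℤˣ) : ℤ) • (cylI' R V a * S b))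
    (hDs : ∀ (j : ℕ) (v : V), D j (S (TensorAlgebra.ι R v)) + S (d j (TensorAlgebra.ι R v)) =
      if j = 1 then cylI'' R V (TensorAlgebra.ι R v) - cylI' R V (TensorAlgebra.ι R v) else 0)
    {ℬ : ℤ × ℤ → Submodule R B} {dB : ℕ → (B →ₗ[R] B)} (hB : IsMultialgebra R B ℬ dB)
    {f' f'' h : ℕ → (TensorAlgebra R V →ₗ[R] B)}
    (hf' : IsMAlgMorphism R (tGrade R V 𝒱) ℬ d dB f')
    (hf'' : IsMAlgMorphism R (tGrade R V 𝒱) ℬ d dB f'')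
    (h_one : (1 : TensorAlgebra R V) ∈ tGrade R V 𝒱 (0, 0))
    (hh : IsMAlgHomotopy R (tGrade R V 𝒱) ℬ d dB f' f'' h) :
    ∃! H : ℕ → (TensorAlgebra R (V × V × V) →ₗ[R] B),
      IsMAlgMorphism R (tGrade R (V × V × V) (cylGrade R V 𝒱)) ℬ D dB H ∧
      (∀ k, (H k).comp (cylI' R V).toLinearMap = f' k) ∧
      (∀ k, (H k).comp (cylI'' R V).toLinearMap = f'' k) ∧
      (∀ m, (H m).comp S = h m) := by
  have one_f : ∀ {f : ℕ → (TensorAlgebra R V →ₗ[R] B)},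
      IsMAlgMorphism R (tGrade R V 𝒱) ℬ d dB f → ∀ k, f k 1 = if k = 0 then 1 else 0 := by
    intro f hf k
    split_ifs with hk
    · rw [hk]; exact hf.2.2.1
    · exact hf.2.2.2.1 k (Nat.pos_of_ne_zero hk)
  have one_h : ∀ k, h k 1 = 0 := by
    intro k
    have := hh.2.2 k (0, 0) 1 h_one 1
    rw [mul_one, Finset.sum_add_distrib, Finset.sum_eq_single k, Finset.sum_eq_single k] at this
    · simpa [one_f hf', one_f hf''] using this
    all_goals
      first
      | (intro i hi hik
         rw [Finset.mem_range] at hi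
         simp [one_f hf', one_f hf'', show k - i ≠ 0 by omega])
      | simp
  set φ : ℕ → (V × V × V →ₗ[R] B) := fun k =>
    ((f' k).comp (TensorAlgebra.ι R)).coprod
      (((f'' k).comp (TensorAlgebra.ι R)).coprod ((h k).comp (TensorAlgebra.ι R))) with hφ
  set H := multExt φ with hH
  have H1 : ∀ k v, H k (TensorAlgebra.ι R (cylE1 R V v)) = f' k (TensorAlgebra.ι R v) := by
    intro k v; simp [hH, multExt_ι, hφ, cylE1]
  have H2 : ∀ k v, H k (TensorAlgebra.ι R (cylE2 R V v)) = f'' k (TensorAlgebra.ι R v) := by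
    intro k v; simp [hH, multExt_ι, hφ, cylE2]
  have H3 : ∀ k v, H k (TensorAlgebra.ι R (cylE3 R V v)) = h k (TensorAlgebra.ι R v) := by
    intro k v; simp [hH, multExt_ι, hφ, cylE3]
  have Hmul : ∀ k a b, H k (a * b) = ∑ i ∈ Finset.range (k + 1), H i a * H (k - i) b :=
    multExt_mul φ
  have Hone : ∀ k, H k 1 = if k = 0 then 1 else 0 := multExt_one φ
  have Hi' : (fun k => (H k).comp (cylI' R V).toLinearMap) = f' :=
    multiplicative_ext _ _ (fun k => by simp [Hone, one_f hf'])
      (fun k a b => by simp [Hmul]) hf'.2.2.2.2 (fun k w => by simp [cylI'_ι, H1])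
  have Hi'' : (fun k => (H k).comp (cylI'' R V).toLinearMap) = f'' :=
    multiplicative_ext _ _ (fun k => by simp [Hone, one_f hf''])
      (fun k a b => by simp [Hmul]) hf''.2.2.2.2 (fun k w => by simp [cylI''_ι, H2])
  have e1 : ∀ k x, H k (cylI' R V x) = f' k x := fun k x =>
    LinearMap.congr_fun (congrFun Hi' k) x
  have e2 : ∀ k x, H k (cylI'' R V x) = f'' k x := fun k x =>
    LinearMap.congr_fun (congrFun Hi'' k) x
  have e3 : ∀ k x, H k (S x) = h k x := by
    have key : ∀ x, x ∈ ⨅ k, LinearMap.ker ((H k).comp S - h k) := by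
      refine TensorAlgebra.mem_of_ι_mul_mem h𝒱 _ ?_ ?_
      · simp [hS1, one_h]
      · intro pq v hv b hb
        simp only [Submodule.mem_iInf, LinearMap.mem_ker, LinearMap.sub_apply, sub_eq_zero,
          LinearMap.comp_apply] at hb ⊢
        intro k
        have hι := ι_mem_tGrade (R := R) hv
        rw [hSder pq _ hι, hh.2.2 k pq _ hι, map_add, map_zsmul, Hmul, Hmul,
          Finset.sum_add_distrib, Finset.smul_sum]
        simp only [e1, e2, hb, hSv, H3]
        rw [sum_range_reflect_sub k fun i j => _ • (f' i (TensorAlgebra.ι R v) * h j b)]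
    intro k x
    have := key x
    simp only [Submodule.mem_iInf, LinearMap.mem_ker, LinearMap.sub_apply, sub_eq_zero] at this
    exact this k
  have Hdeg : ∀ (k : ℕ) (pq : ℤ × ℤ), ∀ w ∈ cylGrade R V 𝒱 pq,
      H k (TensorAlgebra.ι R w) ∈ ℬ (pq.1 - k, pq.2 + k) := by
    rintro k pq w ⟨hw1, hw2, hw3⟩
    rw [cyl_decomp (R := R) w, map_add, map_add, map_add, map_add, H1, H2, H3]
    refine add_mem (add_mem (hf'.1 k pq _ (ι_mem_tGrade hw1))
      (hf''.1 k pq _ (ι_mem_tGrade hw2))) ?_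
    convert hh.1 k _ _ (ι_mem_tGrade hw3) using 2
    simp only [Prod.mk.injEq, and_true]
    ring
  have chain : ∀ (k : ℕ) (x : TensorAlgebra R (V × V × V)),
      ∑ i ∈ Finset.range (k + 1), dB i (H (k - i) x) =
        ∑ i ∈ Finset.range (k + 1), H i (D (k - i) x) := by
    have D1 : ∀ j x, D j (cylI' R V x) = cylI' R V (d j x) := fun j x =>
      LinearMap.congr_fun (hDi' j) x
    have D2 : ∀ j x, D j (cylI'' R V x) = cylI'' R V (d j x) := fun j x =>
      LinearMap.congr_fun (hDi'' j) x
    have c1 := fun k x => LinearMap.congr_fun (hf'.2.1 k) x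
    have c2 := fun k x => LinearMap.congr_fun (hf''.2.1 k) x
    have c3 := fun k x => LinearMap.congr_fun (hh.2.1 k) x
    simp only [LinearMap.sum_apply, LinearMap.comp_apply, LinearMap.add_apply] at c1 c2 c3
    have gen : ∀ (w : V × V × V) (k : ℕ),
        ∑ i ∈ Finset.range (k + 1), dB i (H (k - i) (TensorAlgebra.ι R w)) =
          ∑ i ∈ Finset.range (k + 1), H i (D (k - i) (TensorAlgebra.ι R w)) := by
      intro w k
      rw [cyl_decomp (R := R) w]
      simp only [map_add, Finset.sum_add_distrib]
      simp only [← cylI'_ι, ← cylI''_ι, ← hSv, D1, D2, e1, e2, e3]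
      rw [c1, c2]
      congr 1
      have h3 := c3 k (TensorAlgebra.ι R w.2.2)
      have hD3 : ∀ j, D j (S (TensorAlgebra.ι R w.2.2)) = _ := fun j =>
        eq_sub_of_add_eq (hDs j w.2.2)
      simp only [hD3, map_sub, Finset.sum_sub_distrib, e3]
      rw [sum_range_ite_sub_eq_one, map_sub, e1, e2, eq_sub_iff_add_eq,
        ← Finset.sum_add_distrib, h3]
      split_ifs <;> simp
    have key : ∀ x, x ∈ ⨅ k, LinearMap.ker
        (∑ i ∈ Finset.range (k + 1), (dB i).comp (H (k - i)) -
          ∑ i ∈ Finset.range (k + 1), (H i).comp (D (k - i))) := by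
      refine TensorAlgebra.mem_of_ι_mul_mem (iSup_cylGrade h𝒱) _ ?_ ?_
      · simp [hD.differential_one, Hone, apply_ite, hB.differential_one]
      · intro pq w hw b hb
        simp only [Submodule.mem_iInf, LinearMap.mem_ker, LinearMap.sub_apply, sub_eq_zero,
          LinearMap.comp_apply, LinearMap.sum_apply] at hb ⊢
        refine multidifferential_comm_mul D dB H _ b _ Hmul
          (fun i => hD.2.2.2.2.2.1 i pq _ (ι_mem_tGrade hw) b) (fun i j y => ?_) (gen w) hb
        have := hB.2.2.2.2.2.1 i _ _ (Hdeg j pq w hw) y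
        rwa [show pq.1 - (j : ℤ) + (pq.2 + j) = pq.1 + pq.2 by ring] at this
    intro k x
    have := key x
    simp only [Submodule.mem_iInf, LinearMap.mem_ker, LinearMap.sub_apply, sub_eq_zero,
      LinearMap.comp_apply, LinearMap.sum_apply] at this
    exact this k
  refine ⟨H, ⟨⟨?_, ?_, ?_, ?_, Hmul⟩, congrFun Hi', congrFun Hi'', fun m =>
    LinearMap.ext (e3 m)⟩, ?_⟩
  · intro k pq a ha
    have hle := tGrade_le (𝒲 := cylGrade R V 𝒱)
      (fun n => ⨅ k : ℕ, (ℬ (n.1 - k, n.2 + k)).comap (H k)) ?_ ?_ pq ha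
    · exact (Submodule.mem_iInf _).1 hle k
    · simp only [Submodule.mem_iInf, Submodule.mem_comap, Hone]
      intro k
      split_ifs with hk
      · subst hk
        simpa using hB.2.1
      · exact zero_mem _
    · intro i n w hw b hb
      simp only [Submodule.mem_iInf, Submodule.mem_comap, Hmul] at hb ⊢
      intro k
      refine sum_mem fun j hj => ?_
      rw [Finset.mem_range] at hj
      convert hB.2.2.1 _ _ _ (Hdeg j i w hw) _ (hb (k - j)) using 2
      simp only [Prod.fst_add, Prod.snd_add, Prod.mk.injEq]
      push_cast [show j ≤ k by omega]
      constructor <;> ring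
  · intro k
    refine LinearMap.ext fun x => ?_
    simpa using chain k x
  · simp [Hone]
  · intro k hk
    simp [Hone, hk.ne']
  · rintro G ⟨hG, hG', hG'', hGS⟩
    refine multiplicative_ext _ _ (fun k => ?_) hG.2.2.2.2 Hmul fun k w => ?_
    · rw [Hone]
      split_ifs with hk
      · rw [hk]; exact hG.2.2.1
      · exact hG.2.2.2.1 k (Nat.pos_of_ne_zero hk)
    · rw [cyl_decomp (R := R) w]
      simp only [map_add]
      rw [← cylI'_ι, ← cylI''_ι, ← hSv, e1, e2, e3, ← hG', ← hG'', ← hGS]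
      rfl

end Extension

/-- Proposition 2.4.3.  Let `A = (T[V], d)` be a free connected
multialgebra and `A × I = T[V' ⊕ V'' ⊕ sV]` its cylinder, with multidifferential `D`
restricting to (copies of) `d` on `V'`, `V''` and given on `sV` by the formulas
(2.4.2) via the `i'`-`i''`-multiderivation `S` determined by `S v = s v`.  For any
multialgebra `B` and morphisms `f', f'' : A → B` of multialgebras, the formulas
`H i' = f'`, `H i'' = f''`, `H S = h` determine a natural bijection between
multihomotopies `h : f' ≃ f''` of morphisms of multialgebras and morphisms
`H : A × I → B` of multialgebras with `H i' = f'` and `H i'' = f''`. -/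
theorem minimal_multi_models_stmt7 (R V B : Type) [CommRing R]
    [AddCommGroup V] [Module R V] [Module.Free R V]
    [Ring B] [Algebra R B]
    (𝒱 : ℤ × ℤ → Submodule R V) (hV : IsFreeConnectedGen R V 𝒱)
    (d : ℕ → (TensorAlgebra R V →ₗ[R] TensorAlgebra R V))
    (hd : IsMultialgebra R (TensorAlgebra R V) (tGrade R V 𝒱) d)
    (D : ℕ → (TensorAlgebra R (V × V × V) →ₗ[R] TensorAlgebra R (V × V × V)))
    (hD : IsMultialgebra R (TensorAlgebra R (V × V × V)) (tGrade R (V × V × V) (cylGrade R V 𝒱)) D)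
    -- the multidifferential on `V'` and `V''` is (the copy of) that of `V`:
    (hDi' : ∀ i, (D i).comp (cylI' R V).toLinearMap = (cylI' R V).toLinearMap.comp (d i))
    (hDi'' : ∀ i, (D i).comp (cylI'' R V).toLinearMap = (cylI'' R V).toLinearMap.comp (d i))
    -- the `i'`-`i''`-multiderivation `S` with `S v = s v`:
    (S : TensorAlgebra R V →ₗ[R] TensorAlgebra R (V × V × V))
    (hSv : ∀ v : V, S (TensorAlgebra.ι R v) = TensorAlgebra.ι R (cylE3 R V v))
    (hS1 : S 1 = 0)
    (hSder : ∀ (pq : ℤ × ℤ), ∀ a ∈ tGrade R V 𝒱 pq, ∀ b : TensorAlgebra R V,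
      S (a * b) = S a * cylI'' R V b +
        (((-1 : ℤˣ) ^ (pq.1 + pq.2) : ℤˣ) : ℤ) • (cylI' R V a * S b))
    -- the multidifferential on `sV` (formulas (2.4.2)):
    (hD0s : ∀ v : V, D 0 (TensorAlgebra.ι R (cylE3 R V v)) = -S (d 0 (TensorAlgebra.ι R v)))
    (hD1s : ∀ v : V, D 1 (TensorAlgebra.ι R (cylE3 R V v)) =
      TensorAlgebra.ι R (cylE2 R V v) - TensorAlgebra.ι R (cylE1 R V v) -
        S (d 1 (TensorAlgebra.ι R v)))
    (hDjs : ∀ j, 2 ≤ j → ∀ v : V,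
      D j (TensorAlgebra.ι R (cylE3 R V v)) = -S (d j (TensorAlgebra.ι R v)))
    -- the target multialgebra and the two morphisms:
    (ℬ : ℤ × ℤ → Submodule R B) (dB : ℕ → (B →ₗ[R] B))
    (hB : IsMultialgebra R B ℬ dB)
    (f' f'' : ℕ → (TensorAlgebra R V →ₗ[R] B))
    (hf' : IsMAlgMorphism R (tGrade R V 𝒱) ℬ d dB f')
    (hf'' : IsMAlgMorphism R (tGrade R V 𝒱) ℬ d dB f'') :
    -- the bijection `H ↦ H ∘ S`:
    (∀ H : ℕ → (TensorAlgebra R (V × V × V) →ₗ[R] B),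
      IsMAlgMorphism R (tGrade R (V × V × V) (cylGrade R V 𝒱)) ℬ D dB H →
      (∀ k, (H k).comp (cylI' R V).toLinearMap = f' k) →
      (∀ k, (H k).comp (cylI'' R V).toLinearMap = f'' k) →
      IsMAlgHomotopy R (tGrade R V 𝒱) ℬ d dB f' f'' (fun m => (H m).comp S)) ∧
    (∀ h : ℕ → (TensorAlgebra R V →ₗ[R] B),
      IsMAlgHomotopy R (tGrade R V 𝒱) ℬ d dB f' f'' h →
      ∃! H : ℕ → (TensorAlgebra R (V × V × V) →ₗ[R] B),
        IsMAlgMorphism R (tGrade R (V × V × V) (cylGrade R V 𝒱)) ℬ D dB H ∧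
        (∀ k, (H k).comp (cylI' R V).toLinearMap = f' k) ∧
        (∀ k, (H k).comp (cylI'' R V).toLinearMap = f'' k) ∧
        (∀ m, (H m).comp S = h m)) := by
  have h𝒱 : ⨆ i, 𝒱 i = ⊤ := hV.1.submodule_iSup_eq_top
  have hDs : ∀ (j : ℕ) (v : V),
      D j (S (TensorAlgebra.ι R v)) + S (d j (TensorAlgebra.ι R v)) =
        if j = 1 then cylI'' R V (TensorAlgebra.ι R v) - cylI' R V (TensorAlgebra.ι R v)
        else 0 := by
    intro j v
    rw [hSv]
    match j with
    | 0 => rw [hD0s]; simp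
    | 1 => rw [hD1s, cylI'_ι, cylI''_ι]; simp
    | j + 2 => rw [hDjs _ (by omega)]; simp
  refine ⟨fun H hH hH' hH'' => ⟨?_, ?_, ?_⟩, fun h hh => ?_⟩
  · intro k pq a ha
    change H k (S a) ∈ _
    convert hH.1 k _ _ (cyl_S_mem hD hSv hS1 hSder pq ha) using 2
    simp only [Prod.mk.injEq, and_true]
    ring
  · intro m
    refine LinearMap.ext fun x => ?_
    have hc := LinearMap.congr_fun (hH.2.1 m) (S x)
    have hS := cyl_homotopy h𝒱 hd hD hDi' hDi'' hSv hS1 hSder hDs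
    simp only [LinearMap.sum_apply, LinearMap.comp_apply, LinearMap.add_apply] at hc ⊢
    rw [Finset.sum_add_distrib, hc, ← Finset.sum_add_distrib]
    simp only [← map_add, hS]
    rw [sum_range_ite_sub_eq_one, ← hH', ← hH'']
    split_ifs <;> simp
  · intro k pq a ha b
    have e1 : ∀ k x, H k (cylI' R V x) = f' k x := fun k x => LinearMap.congr_fun (hH' k) x
    have e2 : ∀ k x, H k (cylI'' R V x) = f'' k x := fun k x => LinearMap.congr_fun (hH'' k) x
    simp only [LinearMap.comp_apply]
    rw [hSder pq a ha, map_add, map_zsmul, hH.2.2.2.2, hH.2.2.2.2, Finset.sum_add_distrib,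
      Finset.smul_sum]
    simp only [e1, e2]
    rw [sum_range_reflect_sub k fun i j => _ • (f' i a * H j (S b))]
  · exact existsUnique_morphism_of_homotopy h𝒱 hD hDi' hDi'' hSv hS1 hSder hDs hB hf' hf''
      hd.2.1 hh
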